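/- arXiv:1504.04725 — 5 statements merged into one kernel-verified Lean document; each statement's English description precedes it below -/
import Mathlib

section
/- Let m₁, m₂ be positive integers and n₁, n₂ be nonnegative integers with n₁/m₁ < n₂/m₂, and let x, y be real numbers with n₁/m₁ < x < (n₁ + n₂)/(m₁ + m₂) and n₁/m₁ < y < (n₁ + n₂)/(m₁ + m₂). Then (m₁·x − n₁)(m₁·y − n₁) < (m₂·x − n₂)(m₂·y − n₂). -/
/-- To the right of `a/p` and to the left of the mediant `(a+b)/(p+q)`, the affine form `p z - a`
is positive and smaller than `b - q z`. -/
theorem pos_and_lt_of_lt_mediant {K : Type*} [Field K] [LinearOrder K] [IsStrictOrderedRing K]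
    {p q a b z : K} (hp : 0 < p) (hq : 0 < q) (h₁ : a / p < z) (h₂ : z < (a + b) / (p + q)) :
    0 < p * z - a ∧ p * z - a < b - q * z := by
  rw [div_lt_iff₀ hp] at h₁
  rw [lt_div_iff₀ (add_pos hp hq)] at h₂
  constructor <;> linarith

/-- For positive integers `m₁, m₂`, nonnegative integers `n₁, n₂` with
`n₁/m₁ < n₂/m₂`, and reals `x, y` strictly between `n₁/m₁` and the mediant
`(n₁+n₂)/(m₁+m₂)`, one has `(m₁x − n₁)(m₁y − n₁) < (m₂x − n₂)(m₂y − n₂)`. -/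
theorem breakpoint_product_lt (m₁ m₂ n₁ n₂ : ℕ) (hm₁ : 1 ≤ m₁) (hm₂ : 1 ≤ m₂)
    (hlt : (n₁ : ℝ) / (m₁ : ℝ) < (n₂ : ℝ) / (m₂ : ℝ)) (x y : ℝ)
    (hx₁ : (n₁ : ℝ) / (m₁ : ℝ) < x) (hx₂ : x < ((n₁ + n₂ : ℕ) : ℝ) / ((m₁ + m₂ : ℕ) : ℝ))
    (hy₁ : (n₁ : ℝ) / (m₁ : ℝ) < y) (hy₂ : y < ((n₁ + n₂ : ℕ) : ℝ) / ((m₁ + m₂ : ℕ) : ℝ)) :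
    ((m₁ : ℝ) * x - n₁) * ((m₁ : ℝ) * y - n₁) < ((m₂ : ℝ) * x - n₂) * ((m₂ : ℝ) * y - n₂) := by
  have hp : (0 : ℝ) < m₁ := by exact_mod_cast hm₁
  have hq : (0 : ℝ) < m₂ := by exact_mod_cast hm₂
  push_cast at hx₂ hy₂
  obtain ⟨hx_pos, hx_lt⟩ := pos_and_lt_of_lt_mediant hp hq hx₁ hx₂
  obtain ⟨hy_pos, hy_lt⟩ := pos_and_lt_of_lt_mediant hp hq hy₁ hy₂
  calc ((m₁ : ℝ) * x - n₁) * (m₁ * y - n₁)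
      < (n₂ - m₂ * x) * (n₂ - m₂ * y) := mul_lt_mul'' hx_lt hy_lt hx_pos.le hy_pos.le
    _ = (m₂ * x - n₂) * (m₂ * y - n₂) := by ring
end

section
/- Let m₁, m₂ be positive integers and n₁, n₂ be nonnegative integers with n₁/m₁ < n₂/m₂, and let x, y be real numbers with (n₁ + n₂)/(m₁ + m₂) < x < n₂/m₂ and (n₁ + n₂)/(m₁ + m₂) < y < n₂/m₂. Then (m₁·x − n₁)(m₁·y − n₁) > (m₂·x − n₂)(m₂·y − n₂). -/
/-- For positive integers `m₁, m₂`, nonnegative integers `n₁, n₂` with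
`n₁/m₁ < n₂/m₂`, and reals `x, y` strictly between the mediant `(n₁+n₂)/(m₁+m₂)` and
`n₂/m₂`, one has `(m₁x − n₁)(m₁y − n₁) > (m₂x − n₂)(m₂y − n₂)`. -/
theorem breakpoint_product_gt (m₁ m₂ n₁ n₂ : ℕ) (hm₁ : 1 ≤ m₁) (hm₂ : 1 ≤ m₂)
    (hlt : (n₁ : ℝ) / (m₁ : ℝ) < (n₂ : ℝ) / (m₂ : ℝ)) (x y : ℝ)
    (hx₁ : ((n₁ + n₂ : ℕ) : ℝ) / ((m₁ + m₂ : ℕ) : ℝ) < x) (hx₂ : x < (n₂ : ℝ) / (m₂ : ℝ))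
    (hy₁ : ((n₁ + n₂ : ℕ) : ℝ) / ((m₁ + m₂ : ℕ) : ℝ) < y) (hy₂ : y < (n₂ : ℝ) / (m₂ : ℝ)) :
    ((m₂ : ℝ) * x - n₂) * ((m₂ : ℝ) * y - n₂) < ((m₁ : ℝ) * x - n₁) * ((m₁ : ℝ) * y - n₁) := by
  have h₁ : (0 : ℝ) < m₁ := by exact_mod_cast hm₁
  have h₂ : (0 : ℝ) < m₂ := by exact_mod_cast hm₂
  push_cast at hx₁ hy₁
  rw [div_lt_iff₀ (add_pos h₁ h₂)] at hx₁ hy₁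
  rw [lt_div_iff₀ h₂] at hx₂ hy₂
  have key : ((n₂ : ℝ) - m₂ * x) * (n₂ - m₂ * y) < (m₁ * x - n₁) * (m₁ * y - n₁) :=
    mul_lt_mul'' (by linarith) (by linarith) (by linarith) (by linarith)
  linarith
end

section
/- Let k > 3 be an integer, let n₁/m₁ < n₂/m₂ be two successive terms of the Farey sequence 𝔉_k in lowest terms with m₁, m₂ ≥ 1, and let x, y be real numbers with n₁/m₁ < x < n₂/m₂ and n₁/m₁ < y < n₂/m₂. Then for every pair of coprime integers (m, n) with 1 ≤ m ≤ k and 0 ≤ n ≤ m (i.e., n/m ∈ 𝔉_k), one has (m·x − n)(m·y − n) ≥ min{ (m₁·x − n₁)(m₁·y − n₁), (m₂·x − n₂)(m₂·y − n₂) }; that is, F_{m₁n₁} and F_{m₂n₂} are the two worst cases. -/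
/-- The Farey sequence `𝔉ₖ` (as a set): rationals `a/b` in lowest terms with
`0 ≤ a ≤ b ≤ k`, i.e., rationals in `[0,1]` whose reduced denominator is at most `k`. -/
def fareySet (k : ℕ) : Set ℚ := {q : ℚ | 0 ≤ q ∧ q ≤ 1 ∧ q.den ≤ k}

theorem natCast_div_mem_fareySet {k m n : ℕ} (hm : 1 ≤ m) (hmk : m ≤ k) (hnm : n ≤ m) :
    (n : ℚ) / (m : ℚ) ∈ fareySet k := by
  have hm' : (0 : ℚ) < m := by exact_mod_cast hm
  refine ⟨by positivity, (div_le_one hm').2 (by exact_mod_cast hnm), ?_⟩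
  have h := Rat.den_dvd (n : ℤ) (m : ℤ)
  rw [Rat.divInt_eq_div] at h
  push_cast at h
  exact (Nat.le_of_dvd hm (by exact_mod_cast h)).trans hmk

theorem le_of_natCast_div_mem_fareySet {k m n : ℕ} (hm : 1 ≤ m) (hcop : Nat.Coprime n m)
    (h : (n : ℚ) / (m : ℚ) ∈ fareySet k) : m ≤ k ∧ n ≤ m := by
  have hm' : (0 : ℚ) < m := by exact_mod_cast hm
  obtain ⟨-, h1, h2⟩ := h
  have hden := Rat.den_div_eq_of_coprime (a := (n : ℤ)) (b := (m : ℤ))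
    (by exact_mod_cast hm) (by simpa using hcop)
  push_cast at hden
  have hden' : ((n : ℚ) / (m : ℚ)).den = m := by exact_mod_cast hden
  exact ⟨hden' ▸ h2, by exact_mod_cast (div_le_one hm').1 h1⟩

theorem exists_mul_sub_mul_eq_one_of_coprime {m n : ℕ} (k : ℕ) (hm : 1 ≤ m)
    (hcop : Nat.Coprime n m) :
    ∃ p q : ℤ, (m : ℤ) * q - n * p = 1 ∧ (k : ℤ) - m < p ∧ p ≤ k := by
  have hm' : (0 : ℤ) < m := by exact_mod_cast hm
  obtain ⟨a, b, hab⟩ := Nat.isCoprime_iff_coprime.2 hcop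
  have hdiv := Int.emod_add_mul_ediv ((k : ℤ) + a) m
  have hnonneg := Int.emod_nonneg ((k : ℤ) + a) hm'.ne'
  have hlt := Int.emod_lt_of_pos ((k : ℤ) + a) hm'
  refine ⟨-a + m * (((k : ℤ) + a) / m), b + n * (((k : ℤ) + a) / m), ?_, ?_, ?_⟩
  · linear_combination hab
  · linarith
  · linarith

/-- Successive terms of a Farey sequence are unimodular. -/
theorem fareySet_successive_det_eq_one {k m₁ n₁ m₂ n₂ : ℕ}
    (hm₁ : 1 ≤ m₁) (hm₂ : 1 ≤ m₂)
    (hcop₁ : Nat.Coprime n₁ m₁) (hcop₂ : Nat.Coprime n₂ m₂)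
    (hmem₁ : (n₁ : ℚ) / (m₁ : ℚ) ∈ fareySet k)
    (hmem₂ : (n₂ : ℚ) / (m₂ : ℚ) ∈ fareySet k)
    (hlt : (n₁ : ℚ) / (m₁ : ℚ) < (n₂ : ℚ) / (m₂ : ℚ))
    (hsucc : ∀ z ∈ fareySet k, ¬((n₁ : ℚ) / (m₁ : ℚ) < z ∧ z < (n₂ : ℚ) / (m₂ : ℚ))) :
    (m₁ : ℤ) * n₂ - n₁ * m₂ = 1 := by
  obtain ⟨hmk₁, -⟩ := le_of_natCast_div_mem_fareySet hm₁ hcop₁ hmem₁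
  obtain ⟨hmk₂, hnm₂⟩ := le_of_natCast_div_mem_fareySet hm₂ hcop₂ hmem₂
  have hm₁' : (0 : ℚ) < m₁ := by exact_mod_cast hm₁
  have hm₂' : (0 : ℚ) < m₂ := by exact_mod_cast hm₂
  rw [div_lt_div_iff₀ hm₁' hm₂'] at hlt
  have hlt' : (n₁ : ℤ) * m₂ < n₂ * m₁ := by exact_mod_cast hlt
  obtain ⟨p, q, hdet, hpk, hpk'⟩ := exists_mul_sub_mul_eq_one_of_coprime k hm₁ hcop₁
  have hp : 0 < p := by omega
  have hm₁z : (0 : ℤ) < m₁ := by exact_mod_cast hm₁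
  have hq : 0 < q := by
    have : 0 ≤ (n₁ : ℤ) * p := by positivity
    exact pos_of_mul_pos_right (by linarith : 0 < (m₁ : ℤ) * q) hm₁z.le
  lift p to ℕ using hp.le
  lift q to ℕ using hq.le
  have hp' : (0 : ℚ) < p := by exact_mod_cast hp
  have hle : (p : ℤ) * n₂ ≤ q * m₂ := by
    by_contra! hcon
    have hqp : q ≤ p := by
      have h1 : q * m₂ < p * n₂ := by exact_mod_cast hcon
      exact (lt_of_mul_lt_mul_right (h1.trans_le (Nat.mul_le_mul_left p hnm₂))
        (Nat.zero_le _)).le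
    refine hsucc _ (natCast_div_mem_fareySet (by exact_mod_cast hp) (by exact_mod_cast hpk') hqp)
      ⟨?_, ?_⟩
    · rw [div_lt_div_iff₀ hm₁' hp']
      have : (n₁ : ℤ) * p < q * m₁ := by linarith
      exact_mod_cast this
    · rw [div_lt_div_iff₀ hp' hm₂']
      have : (q : ℤ) * m₂ < n₂ * p := by linarith
      exact_mod_cast this
  have hm₂_eq : (m₁ : ℤ) * (q * m₂ - p * n₂) = m₂ - p * (m₁ * n₂ - n₁ * m₂) := by
    linear_combination (m₂ : ℤ) * hdet
  have hn₂_eq : (n₁ : ℤ) * (q * m₂ - p * n₂) = n₂ - q * (m₁ * n₂ - n₁ * m₂) := by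
    linear_combination (n₂ : ℤ) * hdet
  have hzero : (q : ℤ) * m₂ - p * n₂ = 0 := by
    by_contra hne
    have h1 : 1 ≤ (q : ℤ) * m₂ - p * n₂ := by omega
    have h2 : 1 ≤ (m₁ : ℤ) * n₂ - n₁ * m₂ := by linarith
    have h3 : (m₂ : ℤ) ≤ k := by exact_mod_cast hmk₂
    nlinarith
  rw [hzero, mul_zero] at hm₂_eq hn₂_eq
  have hunit : IsUnit ((m₁ : ℤ) * n₂ - n₁ * m₂) :=
    (Nat.isCoprime_iff_coprime.2 hcop₂).isUnit_of_dvd'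
      ⟨q, by linarith⟩ ⟨p, by linarith⟩
  rcases Int.isUnit_iff.1 hunit with h | h
  · exact h
  · linarith

/-- A linear form with integer slope and root `n / m ≤ n₁ / m₁` dominates the one attached to
`n₁ / m₁` on the interval up to `n₂ / m₂`. -/
theorem mul_sub_le_mul_sub_of_le {m n m₁ n₁ m₂ n₂ : ℕ}
    (hdet : (m₁ : ℤ) * n₂ - n₁ * m₂ = 1)
    (hle : n * m₁ ≤ n₁ * m) (hlt : n * m₂ < n₂ * m) {x : ℝ}
    (hx₁ : 0 ≤ (m₁ : ℝ) * x - n₁) (hx₂ : 0 ≤ n₂ - (m₂ : ℝ) * x) :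
    (m₁ : ℝ) * x - n₁ ≤ m * x - n := by
  have hdet' : (m₁ : ℝ) * n₂ - n₁ * m₂ = 1 := by exact_mod_cast hdet
  have hle' : (0 : ℝ) ≤ n₁ * m - n * m₁ := sub_nonneg.2 (by exact_mod_cast hle)
  have hlt' : (0 : ℝ) ≤ n₂ * m - n * m₂ - 1 := by
    have : (n : ℝ) * m₂ + 1 ≤ n₂ * m := by exact_mod_cast hlt
    linarith
  have key : (m : ℝ) * x - n = (n₂ * m - n * m₂) * (m₁ * x - n₁)
      + (n₁ * m - n * m₁) * (n₂ - m₂ * x) := by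
    linear_combination -(m * x - n) * hdet'
  nlinarith [mul_nonneg hlt' hx₁, mul_nonneg hle' hx₂]

/-- The mirror image of `mul_sub_le_mul_sub_of_le` for `n₂ / m₂ ≤ n / m`. -/
theorem sub_mul_le_sub_mul_of_le {m n m₁ n₁ m₂ n₂ : ℕ}
    (hdet : (m₁ : ℤ) * n₂ - n₁ * m₂ = 1)
    (hle : n₂ * m ≤ n * m₂) (hlt : n₁ * m < n * m₁) {x : ℝ}
    (hx₁ : 0 ≤ (m₁ : ℝ) * x - n₁) (hx₂ : 0 ≤ n₂ - (m₂ : ℝ) * x) :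
    n₂ - (m₂ : ℝ) * x ≤ n - m * x := by
  have hdet' : (m₁ : ℝ) * n₂ - n₁ * m₂ = 1 := by exact_mod_cast hdet
  have hle' : (0 : ℝ) ≤ n * m₂ - n₂ * m := sub_nonneg.2 (by exact_mod_cast hle)
  have hlt' : (0 : ℝ) ≤ n * m₁ - n₁ * m - 1 := by
    have : (n₁ : ℝ) * m + 1 ≤ n * m₁ := by exact_mod_cast hlt
    linarith
  have key : (n : ℝ) - m * x = (n * m₁ - n₁ * m) * (n₂ - m₂ * x)
      + (n * m₂ - n₂ * m) * (m₁ * x - n₁) := by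
    linear_combination -(n - m * x) * hdet'
  nlinarith [mul_nonneg hlt' hx₂, mul_nonneg hle' hx₁]

/-- Let `n₁/m₁ < n₂/m₂` be successive terms of the Farey sequence `𝔉ₖ`
(`k > 3`), in lowest terms, and let `x, y` be reals strictly between `n₁/m₁` and
`n₂/m₂`. Then for every `n/m ∈ 𝔉ₖ` (coprime `m, n` with `1 ≤ m ≤ k`, `0 ≤ n ≤ m`),
`(m x − n)(m y − n)` is at least the minimum of `(m₁x − n₁)(m₁y − n₁)` and
`(m₂x − n₂)(m₂y − n₂)`: these two are the worst cases. -/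
theorem farey_two_worst_cases (k m₁ n₁ m₂ n₂ : ℕ) (hk : 3 < k)
    (hm₁ : 1 ≤ m₁) (hm₂ : 1 ≤ m₂)
    (hcop₁ : Nat.Coprime n₁ m₁) (hcop₂ : Nat.Coprime n₂ m₂)
    (hmem₁ : (n₁ : ℚ) / (m₁ : ℚ) ∈ fareySet k)
    (hmem₂ : (n₂ : ℚ) / (m₂ : ℚ) ∈ fareySet k)
    (hlt : (n₁ : ℚ) / (m₁ : ℚ) < (n₂ : ℚ) / (m₂ : ℚ))
    (hsucc : ∀ z ∈ fareySet k, ¬((n₁ : ℚ) / (m₁ : ℚ) < z ∧ z < (n₂ : ℚ) / (m₂ : ℚ)))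
    (x y : ℝ)
    (hx₁ : (n₁ : ℝ) / (m₁ : ℝ) < x) (hx₂ : x < (n₂ : ℝ) / (m₂ : ℝ))
    (hy₁ : (n₁ : ℝ) / (m₁ : ℝ) < y) (hy₂ : y < (n₂ : ℝ) / (m₂ : ℝ)) :
    ∀ m n : ℕ, 1 ≤ m → m ≤ k → n ≤ m → Nat.Coprime n m →
      min (((m₁ : ℝ) * x - n₁) * ((m₁ : ℝ) * y - n₁))
          (((m₂ : ℝ) * x - n₂) * ((m₂ : ℝ) * y - n₂)) ≤
        ((m : ℝ) * x - n) * ((m : ℝ) * y - n) := by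
  intro m n hm hmk hnm _
  have hdet := fareySet_successive_det_eq_one hm₁ hm₂ hcop₁ hcop₂ hmem₁ hmem₂ hlt hsucc
  have hgap := hsucc _ (natCast_div_mem_fareySet hm hmk hnm)
  have hmQ : (0 : ℚ) < m := by exact_mod_cast hm
  have hmQ₁ : (0 : ℚ) < m₁ := by exact_mod_cast hm₁
  have hmQ₂ : (0 : ℚ) < m₂ := by exact_mod_cast hm₂
  have hmR₁ : (0 : ℝ) < m₁ := by exact_mod_cast hm₁
  have hmR₂ : (0 : ℝ) < m₂ := by exact_mod_cast hm₂
  rw [div_lt_iff₀' hmR₁, ← sub_pos] at hx₁ hy₁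
  rw [lt_div_iff₀' hmR₂, ← sub_pos] at hx₂ hy₂
  rcases le_or_gt ((n : ℚ) / m) ((n₁ : ℚ) / m₁) with hle | hgt
  · have hlt' := hle.trans_lt hlt
    rw [div_le_div_iff₀ hmQ hmQ₁] at hle
    rw [div_lt_div_iff₀ hmQ hmQ₂] at hlt'
    have hbound {z : ℝ} := mul_sub_le_mul_sub_of_le (x := z) hdet
      (by exact_mod_cast hle) (by exact_mod_cast hlt')
    have hbx := hbound hx₁.le hx₂.le
    exact (min_le_left _ _).trans
      (mul_le_mul hbx (hbound hy₁.le hy₂.le) hy₁.le (hx₁.le.trans hbx))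
  · have hge : (n₂ : ℚ) / m₂ ≤ n / m := not_lt.1 fun h => hgap ⟨hgt, h⟩
    rw [div_le_div_iff₀ hmQ₂ hmQ] at hge
    rw [div_lt_div_iff₀ hmQ₁ hmQ] at hgt
    have hbound {z : ℝ} := sub_mul_le_sub_mul_of_le (x := z) hdet
      (by exact_mod_cast hge) (by exact_mod_cast hgt)
    have hbx := hbound hx₁.le hx₂.le
    refine (min_le_right _ _).trans ?_
    have h := mul_le_mul hbx (hbound hy₁.le hy₂.le) hy₂.le (hx₂.le.trans hbx)
    linarith
end

section
/- Fix a positive integer p. Call a 2×2 real matrix F with entries f₁₁, f₁₂, f₂₁, f₂₂ feasible if all four entries are strictly positive, f₁₁ + f₁₂ + f₂₁ + f₂₂ = 1, and for every pair of integers (m, n) with |m| ≤ 2^p − 1, |n| ≤ 2^p − 1, and (m, n) ≠ (0, 0), one has (m·f₁₁ + n·f₁₂)(m·f₂₁ + n·f₂₂) > 0. For a feasible F define J(F) as the minimum of (m·f₁₁ + n·f₁₂)(m·f₂₁ + n·f₂₂) over all such pairs (m, n). Then the matrix F* with f₁₁ = f₂₁ = 1/(2 + 2^{p+1}) and f₁₂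 = f₂₂ = 2^p/(2 + 2^{p+1}) is feasible, and for every feasible F one has J(F) ≤ J(F*); the same holds for the column-swapped matrix with f₁₁ = f₂₁ = 2^p/(2 + 2^{p+1}) and f₁₂ = f₂₂ = 1/(2 + 2^{p+1}). (Theorem 3: this F* solves the max–min full large-scale diversity space code design problem, so the repetition code is the optimal linear space code.) -/
/-- A 2×2 coding matrix with entries `f₁₁ f₁₂ f₂₁ f₂₂` is feasible for `2^p`-ary PAM:
all entries positive, total power `1`, and every error product
`(m f₁₁ + n f₁₂)(m f₂₁ + n f₂₂)` is strictly positive for integer pairs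
`(m, n) ≠ (0, 0)` with `|m|, |n| ≤ 2^p − 1`. -/
def Feasible (p : ℕ) (f₁₁ f₁₂ f₂₁ f₂₂ : ℝ) : Prop :=
  0 < f₁₁ ∧ 0 < f₁₂ ∧ 0 < f₂₁ ∧ 0 < f₂₂ ∧ f₁₁ + f₁₂ + f₂₁ + f₂₂ = 1 ∧
    ∀ m n : ℤ, |m| ≤ 2 ^ p - 1 → |n| ≤ 2 ^ p - 1 → (m, n) ≠ (0, 0) →
      0 < ((m : ℝ) * f₁₁ + (n : ℝ) * f₁₂) * ((m : ℝ) * f₂₁ + (n : ℝ) * f₂₂)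

/-- The worst-case (minimum) error product `J(F)` of the coding matrix `F`. -/
noncomputable def worstCase (p : ℕ) (f₁₁ f₁₂ f₂₁ f₂₂ : ℝ) : ℝ :=
  sInf {x : ℝ | ∃ m n : ℤ, |m| ≤ 2 ^ p - 1 ∧ |n| ≤ 2 ^ p - 1 ∧ (m, n) ≠ (0, 0) ∧
    x = ((m : ℝ) * f₁₁ + (n : ℝ) * f₁₂) * ((m : ℝ) * f₂₁ + (n : ℝ) * f₂₂)}

/-- If the two rows of a matrix give a positive error product for all `(m, n) ≠ 0` in the box
`|m|, |n| ≤ K - 1`, then both slopes lie strictly between two Farey neighbours `u / v`, `u' / v'`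
from the box whose mediant has numerator plus denominator at least `k`, for any `k ≤ K + 1`. -/
theorem exists_farey_neighbours {K : ℤ} (hK : 2 ≤ K) {a b c d : ℝ}
    (ha : 0 < a) (hb : 0 < b) (hc : 0 < c) (hd : 0 < d)
    (h : ∀ m n : ℤ, |m| ≤ K - 1 → |n| ≤ K - 1 → (m, n) ≠ (0, 0) →
      0 < ((m : ℝ) * a + (n : ℝ) * b) * ((m : ℝ) * c + (n : ℝ) * d))
    (k : ℕ) (hk : (k : ℤ) ≤ K + 1) :
    ∃ u v u' v' : ℤ, (0 ≤ u ∧ 0 ≤ v ∧ 0 ≤ u' ∧ 0 ≤ v') ∧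
      (u ≤ K - 1 ∧ v ≤ K - 1 ∧ u' ≤ K - 1 ∧ v' ≤ K - 1) ∧ u' * v - u * v' = 1 ∧
      (0 < v * b - u * a ∧ 0 < v * d - u * c) ∧ (0 < u' * a - v' * b ∧ 0 < u' * c - v' * d) ∧
      (k : ℤ) ≤ u + v + u' + v' := by
  induction k with
  | zero =>
    refine ⟨0, 1, 1, 0, by simp, by omega, by simp, by simp [hb, hd], by simp [ha, hc], by simp⟩
  | succ k ih =>
    push_cast at hk
    obtain ⟨u, v, u', v', ⟨hu, hv, hu', hv'⟩, ⟨bu, bv, bu', bv'⟩, hdet, ⟨x1, y1⟩, ⟨x2, y2⟩, hs⟩ :=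
      ih (by omega)
    by_cases hlt : (k : ℤ) + 1 ≤ u + v + u' + v'
    · exact ⟨u, v, u', v', ⟨hu, hv, hu', hv'⟩, ⟨bu, bv, bu', bv'⟩, hdet, ⟨x1, y1⟩, ⟨x2, y2⟩,
        by exact_mod_cast hlt⟩
    have hpos {w z w' z' : ℤ} (hw : 0 ≤ w) (hz : 0 ≤ z) (e : w * w' + z * z' ≠ 0) :
        1 ≤ w + z := by
      by_contra hcon
      obtain rfl : w = 0 := by omega
      obtain rfl : z = 0 := by omega
      simp at e
    have h1 : 1 ≤ u + v := hpos (w' := -v') (z' := u') hu hv (by linarith)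
    have h2 : 1 ≤ u' + v' := hpos (w' := v) (z' := -u) hu' hv' (by linarith)
    have h3 : 1 ≤ u + u' := hpos (w' := -v') (z' := v) hu hu' (by linarith)
    have h4 : 1 ≤ v + v' := hpos (w' := u') (z' := -u) hv hv' (by linarith)
    have hmed := h (-(u + u')) (v + v') (by rw [abs_neg, abs_of_nonneg] <;> omega)
      (by rw [abs_of_nonneg] <;> omega) (by simp only [ne_eq, Prod.mk.injEq]; omega)
    push_cast at hmed
    rcases mul_pos_iff.1 hmed with ⟨hx, hy⟩ | ⟨hx, hy⟩
    · refine ⟨u + u', v + v', u', v', by omega, by omega, by linarith, ⟨?_, ?_⟩, ⟨x2, y2⟩, ?_⟩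
      · push_cast; linarith
      · push_cast; linarith
      · push_cast; omega
    · refine ⟨u, v, u + u', v + v', by omega, by omega, by linarith, ⟨x1, y1⟩, ⟨?_, ?_⟩, ?_⟩
      · push_cast; linarith
      · push_cast; linarith
      · push_cast; omega

theorem two_mul_lt_add_of_sq_lt_mul {t x y : ℝ} (hx : 0 < x) (hy : 0 < y)
    (h : t ^ 2 < x * y) : 2 * t < x + y := by
  nlinarith [sq_nonneg (x - y)]

theorem Feasible.worstCase_le_apply {p : ℕ} {a b c d : ℝ} (h : Feasible p a b c d) {m n : ℤ}
    (hm : |m| ≤ 2 ^ p - 1) (hn : |n| ≤ 2 ^ p - 1) (hmn : (m, n) ≠ (0, 0)) :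
    worstCase p a b c d ≤ ((m : ℝ) * a + n * b) * (m * c + n * d) := by
  refine csInf_le ⟨0, ?_⟩ ⟨m, n, hm, hn, hmn, rfl⟩
  rintro x ⟨m, n, hm, hn, hmn, rfl⟩
  exact (h.2.2.2.2.2 m n hm hn hmn).le

theorem two_le_two_pow {p : ℕ} (hp : 0 < p) : (2 : ℤ) ≤ 2 ^ p :=
  le_self_pow₀ (by norm_num) hp.ne'

theorem Feasible.worstCase_le {p : ℕ} (hp : 0 < p) {a b c d : ℝ} (h : Feasible p a b c d) :
    worstCase p a b c d ≤ (1 / (2 + 2 ^ (p + 1))) ^ 2 := by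
  obtain ⟨ha, hb, hc, hd, hsum, hpos⟩ := id h
  obtain ⟨u, v, u', v', ⟨hu, hv, hu', hv'⟩, ⟨bu, bv, bu', bv'⟩, hdet, ⟨x1, y1⟩, ⟨x2, y2⟩, hs⟩ :=
    exists_farey_neighbours (two_le_two_pow hp) ha hb hc hd hpos (2 ^ p + 1) (by push_cast; rfl)
  by_contra! hlt
  have habs {w : ℤ} (h0 : 0 ≤ w) (h1 : w ≤ 2 ^ p - 1) : |w| ≤ 2 ^ p - 1 := by
    rwa [abs_of_nonneg h0]
  have hne {w z w' z' : ℤ} (e : w * w' + z * z' = 1) : (w, z) ≠ (0, 0) := by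
    rintro ⟨⟩
    simp at e
  have J1 := h.worstCase_le_apply (m := -u) (n := v) (by rw [abs_neg]; exact habs hu bu)
    (habs hv bv) (hne (w' := v') (z' := u') (by linarith))
  have J2 := h.worstCase_le_apply (m := u') (n := -v') (habs hu' bu')
    (by rw [abs_neg]; exact habs hv' bv') (hne (w' := v) (z' := u) (by linarith))
  push_cast at J1 J2
  set t : ℝ := 1 / (2 + 2 ^ (p + 1)) with ht
  have A1 : 2 * t < (v * b - u * a) + (v * d - u * c) :=
    two_mul_lt_add_of_sq_lt_mul x1 y1 (by linarith)
  have A2 : 2 * t < (u' * a - v' * b) + (u' * c - v' * d) :=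
    two_mul_lt_add_of_sq_lt_mul x2 y2 (by linarith)
  have htK : 2 * t * (2 ^ p + 1) = 1 := by
    rw [ht, pow_succ]
    field_simp
    ring
  have hdetR : (u' * v - u * v' : ℝ) = 1 := by exact_mod_cast hdet
  have hsR : (2 ^ p + 1 : ℝ) ≤ (u + v) + (u' + v') := by
    have : ((2 : ℤ) ^ p + 1) ≤ (u + v) + (u' + v') := by push_cast at hs; linarith
    exact_mod_cast this
  have hp0 : (0 : ℝ) < 2 ^ p := by positivity
  have ht0 : 0 < t := by positivity
  have B1 : (0 : ℝ) ≤ u + v := by exact_mod_cast add_nonneg hu hv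
  have B2 : (0 : ℝ) ≤ u' + v' := by exact_mod_cast add_nonneg hu' hv'
  have hid : (u' + v') * ((v * b - u * a) + (v * d - u * c)) +
      (u + v) * ((u' * a - v' * b) + (u' * c - v' * d)) = (1 : ℝ) := by
    linear_combination (a + b + c + d) * hdetR + hsum
  have C0 := mul_le_mul_of_nonneg_left hsR (mul_pos two_pos ht0).le
  rcases B1.lt_or_eq with hB | hB
  · nlinarith [mul_lt_mul_of_pos_left A2 hB, mul_le_mul_of_nonneg_left A1.le B2]
  · have : (0 : ℝ) < u' + v' := by linarith
    nlinarith [mul_lt_mul_of_pos_left A1 this, mul_le_mul_of_nonneg_left A2.le B1]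

theorem int_add_mul_ne_zero {K m n : ℤ} (hm : |m| ≤ K - 1) (hmn : (m, n) ≠ (0, 0)) :
    m + n * K ≠ 0 := by
  intro h
  have hn : n = 0 := by
    by_contra hn
    have h1 : |m| = |n| * |K| := by rw [← abs_mul, ← abs_neg (n * K)]; congr 1; linarith
    nlinarith [Int.one_le_abs hn, le_abs_self K, abs_nonneg m, abs_nonneg K]
  subst hn
  simp_all

theorem sq_le_repetition_product {p : ℕ} (t : ℝ) {m n : ℤ} (hm : |m| ≤ 2 ^ p - 1)
    (hmn : (m, n) ≠ (0, 0)) :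
    t ^ 2 ≤ (m * t + n * (2 ^ p * t)) * (m * t + n * (2 ^ p * t)) := by
  have h1 : (1 : ℝ) ≤ (m + n * 2 ^ p) ^ 2 := by
    have := Int.add_one_le_iff.2 (pow_pos (abs_pos.2 (int_add_mul_ne_zero hm hmn)) 2)
    rw [sq_abs] at this
    exact_mod_cast this
  nlinarith [mul_le_mul_of_nonneg_left h1 (sq_nonneg t)]

theorem le_worstCase {p : ℕ} (hp : 0 < p) {a b c d x : ℝ}
    (h : ∀ m n : ℤ, |m| ≤ 2 ^ p - 1 → |n| ≤ 2 ^ p - 1 → (m, n) ≠ (0, 0) →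
      x ≤ ((m : ℝ) * a + n * b) * (m * c + n * d)) :
    x ≤ worstCase p a b c d := by
  have := two_le_two_pow hp
  refine le_csInf ⟨_, 1, 0, by rw [abs_one]; omega, by rw [abs_zero]; omega, by simp, rfl⟩ ?_
  rintro _ ⟨m, n, hm, hn, hmn, rfl⟩
  exact h m n hm hn hmn

/-- Theorem 3: the matrix `F*` with `f₁₁ = f₂₁ = 1/(2 + 2^(p+1))`,
`f₁₂ = f₂₂ = 2^p/(2 + 2^(p+1))` is feasible and maximizes the worst-case error
product `J` among all feasible matrices; likewise for its column-swapped version.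
Hence the repetition code is the optimal linear space code. -/
theorem repetition_code_optimal (p : ℕ) (hp : 0 < p) :
    (Feasible p (1 / (2 + 2 ^ (p + 1))) (2 ^ p / (2 + 2 ^ (p + 1)))
        (1 / (2 + 2 ^ (p + 1))) (2 ^ p / (2 + 2 ^ (p + 1))) ∧
      ∀ f₁₁ f₁₂ f₂₁ f₂₂ : ℝ, Feasible p f₁₁ f₁₂ f₂₁ f₂₂ →
        worstCase p f₁₁ f₁₂ f₂₁ f₂₂ ≤
          worstCase p (1 / (2 + 2 ^ (p + 1))) (2 ^ p / (2 + 2 ^ (p + 1)))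
            (1 / (2 + 2 ^ (p + 1))) (2 ^ p / (2 + 2 ^ (p + 1)))) ∧
    (Feasible p (2 ^ p / (2 + 2 ^ (p + 1))) (1 / (2 + 2 ^ (p + 1)))
        (2 ^ p / (2 + 2 ^ (p + 1))) (1 / (2 + 2 ^ (p + 1))) ∧
      ∀ f₁₁ f₁₂ f₂₁ f₂₂ : ℝ, Feasible p f₁₁ f₁₂ f₂₁ f₂₂ →
        worstCase p f₁₁ f₁₂ f₂₁ f₂₂ ≤
          worstCase p (2 ^ p / (2 + 2 ^ (p + 1))) (1 / (2 + 2 ^ (p + 1)))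
            (2 ^ p / (2 + 2 ^ (p + 1))) (1 / (2 + 2 ^ (p + 1)))) := by
  have ht : (0 : ℝ) < 1 / (2 + 2 ^ (p + 1)) := by positivity
  have hsum : (1 / (2 + 2 ^ (p + 1)) + 2 ^ p / (2 + 2 ^ (p + 1)) +
      1 / (2 + 2 ^ (p + 1)) + 2 ^ p / (2 + 2 ^ (p + 1)) : ℝ) = 1 := by
    rw [pow_succ]
    field_simp
    ring
  rw [div_eq_mul_one_div ((2 : ℝ) ^ p)] at hsum ⊢
  set t : ℝ := 1 / (2 + 2 ^ (p + 1))
  have hKt : 0 < 2 ^ p * t := by positivity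
  have key (m n : ℤ) (hm : |m| ≤ 2 ^ p - 1) (_ : |n| ≤ 2 ^ p - 1) (hmn : (m, n) ≠ (0, 0)) :
      t ^ 2 ≤ (m * t + n * (2 ^ p * t)) * (m * t + n * (2 ^ p * t)) :=
    sq_le_repetition_product t hm hmn
  have key_swap (m n : ℤ) (_ : |m| ≤ 2 ^ p - 1) (hn : |n| ≤ 2 ^ p - 1) (hmn : (m, n) ≠ (0, 0)) :
      t ^ 2 ≤ (m * (2 ^ p * t) + n * t) * (m * (2 ^ p * t) + n * t) := by
    rw [add_comm]
    exact sq_le_repetition_product t hn fun h => hmn (by simp_all)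
  exact ⟨⟨⟨ht, hKt, ht, hKt, hsum, fun m n hm hn hmn =>
      (pow_pos ht 2).trans_le (key m n hm hn hmn)⟩,
      fun _ _ _ _ h => (h.worstCase_le hp).trans (le_worstCase hp key)⟩,
    ⟨hKt, ht, hKt, ht, by linarith, fun m n hm hn hmn =>
      (pow_pos ht 2).trans_le (key_swap m n hm hn hmn)⟩,
    fun _ _ _ _ h => (h.worstCase_le hp).trans (le_worstCase hp key_swap)⟩
end

section
/- Fix a positive integer p and let F* be the 2×2 matrix with f₁₁ = f₂₁ = 1/(2 + 2^{p+1}) and f₁₂ = f₂₂ = 2^p/(2 + 2^{p+1}). Then the minimum of (m·f₁₁ + n·f₁₂)(m·f₂₁ + n·f₂₂) over all integer pairs (m, n) with |m| ≤ 2^p − 1, |n| ≤ 2^p − 1 and (m, n) ≠ (0, 0) equals 1/(2 + 2^{p+1})², and every such product is strictly positive. -/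
/-- If `|m| < q`, then `m + n * q` vanishes only when `m = n = 0`. -/
theorem Int.add_mul_ne_zero_of_abs_lt {m n q : ℤ} (hm : |m| < q) (hmn : (m, n) ≠ (0, 0)) :
    m + n * q ≠ 0 := by
  intro h
  have hm0 : m = 0 := Int.eq_zero_of_abs_lt_dvd ⟨-n, by linarith⟩ hm
  have hq : q ≠ 0 := ((abs_nonneg m).trans_lt hm).ne'
  have hn0 : n = 0 := by simpa [hm0, hq] using h
  exact hmn (by rw [hm0, hn0])

theorem sq_le_error_product {m n q : ℤ} (hm : |m| ≤ q - 1) (hmn : (m, n) ≠ (0, 0)) (d : ℝ) :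
    (1 / d) ^ 2 ≤ (m * (1 / d) + n * (q / d)) * (m * (1 / d) + n * (q / d)) := by
  have hne : m + n * q ≠ 0 := Int.add_mul_ne_zero_of_abs_lt (by linarith) hmn
  have hone : (1 : ℝ) ≤ (m + n * q) ^ 2 := by
    exact_mod_cast Int.add_one_le_of_lt (show 0 < (m + n * q) ^ 2 by positivity)
  calc (1 / d) ^ 2 ≤ (m + n * q) ^ 2 * (1 / d) ^ 2 :=
        le_mul_of_one_le_left (sq_nonneg _) hone
    _ = _ := by ring

/-- For the optimal matrix `F*` with `f₁₁ = f₂₁ = 1/(2 + 2^(p+1))` and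
`f₁₂ = f₂₂ = 2^p/(2 + 2^(p+1))`, the minimum of the error products
`(m f₁₁ + n f₁₂)(m f₂₁ + n f₂₂)` over integer pairs `(m, n) ≠ (0, 0)` with
`|m|, |n| ≤ 2^p − 1` equals `1/(2 + 2^(p+1))²`, and every such product is
strictly positive. -/
theorem optimal_matrix_min_value (p : ℕ) (hp : 0 < p) :
    IsLeast
      {x : ℝ | ∃ m n : ℤ, |m| ≤ 2 ^ p - 1 ∧ |n| ≤ 2 ^ p - 1 ∧ (m, n) ≠ (0, 0) ∧
        x = ((m : ℝ) * (1 / (2 + 2 ^ (p + 1))) + (n : ℝ) * (2 ^ p / (2 + 2 ^ (p + 1)))) *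
            ((m : ℝ) * (1 / (2 + 2 ^ (p + 1))) + (n : ℝ) * (2 ^ p / (2 + 2 ^ (p + 1))))}
      ((1 / (2 + 2 ^ (p + 1))) ^ 2) ∧
    ∀ m n : ℤ, |m| ≤ 2 ^ p - 1 → |n| ≤ 2 ^ p - 1 → (m, n) ≠ (0, 0) →
      0 < ((m : ℝ) * (1 / (2 + 2 ^ (p + 1))) + (n : ℝ) * (2 ^ p / (2 + 2 ^ (p + 1)))) *
          ((m : ℝ) * (1 / (2 + 2 ^ (p + 1))) + (n : ℝ) * (2 ^ p / (2 + 2 ^ (p + 1)))) := by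
  have bound : ∀ m n : ℤ, |m| ≤ 2 ^ p - 1 → (m, n) ≠ (0, 0) →
      (1 / (2 + 2 ^ (p + 1)) : ℝ) ^ 2 ≤
        ((m : ℝ) * (1 / (2 + 2 ^ (p + 1))) + (n : ℝ) * (2 ^ p / (2 + 2 ^ (p + 1)))) *
          ((m : ℝ) * (1 / (2 + 2 ^ (p + 1))) + (n : ℝ) * (2 ^ p / (2 + 2 ^ (p + 1)))) := by
    intro m n hm hmn
    simpa only [Int.cast_pow, Int.cast_ofNat] using
      sq_le_error_product (q := 2 ^ p) hm hmn (2 + 2 ^ (p + 1))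
  have hpow : (2 : ℤ) ≤ 2 ^ p := le_self_pow₀ (by norm_num) hp.ne'
  refine ⟨⟨⟨1, 0, ?_, ?_, by simp, by push_cast; ring⟩, ?_⟩, ?_⟩
  · rw [abs_one]
    linarith
  · rw [abs_zero]
    linarith
  · rintro x ⟨m, n, hm, -, hmn, rfl⟩
    exact bound m n hm hmn
  · intro m n hm _ hmn
    exact lt_of_lt_of_le (by positivity) (bound m n hm hmn)
end
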